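/- arXiv:1801.05873 — 2 statements merged into one kernel-verified Lean document; each statement's English description precedes it below -/
import Mathlib

section
/- Let M ≥ 1 be an integer, g > 0, τ > 0, λ ∈ (0,1), and r̃ ∈ ℂ^M. Then the denominator m_g(r̃) = (1−λ)·φ_{τ²}^{(M)}(r̃) + λ·∫_{ℂ^M} φ_{g²}^{(M)}(r)·φ_{τ²}^{(M)}(r̃−r) dr is strictly positive and the Bayes posterior mean satisfies (λ·∫_{ℂ^M} r·φ_{g²}^{(M)}(r)·φ_{τ²}^{(M)}(r̃−r) dr) / m_g(r̃) = (g²/(g²+τ²))·r̃ / (1 + ((1−λ)/λ)·((g²+τ²)/τ²)^M·exp(−Δ·‖r̃‖²)), where Δ = 1/τ² − 1/(g²+τ²). -/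
open MeasureTheory Set
open scoped ENNReal

noncomputable section

/-- `Q(g) = ∫_{b ln g + c}^∞ exp(-s²) ds`. -/
def Qfun (b c g : ℝ) : ℝ := ∫ s in Set.Ioi (b * Real.log g + c), Real.exp (-s ^ 2)

/-- Squared Euclidean norm on `ℂ^M ≅ ℝ^{2M}`. -/
def nsq {M : ℕ} (r : Fin M → ℂ) : ℝ := ∑ i, ‖r i‖ ^ 2

/-- Circularly symmetric complex Gaussian density of variance `v` on `ℂ^M ≅ ℝ^{2M}`:
`φ_v^{(M)}(r) = (πv)^{-M} exp(-‖r‖²/v)`. -/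
def vgauss (M : ℕ) (v : ℝ) (r : Fin M → ℂ) : ℝ :=
  ((Real.pi * v) ^ M)⁻¹ * Real.exp (-nsq r / v)

/-- Channel-row density `q_M(r) = a π^{-M} ∫₀^∞ g^{-γ-2M} Q(g) exp(-‖r‖²/g²) dg`. -/
def qM (a γ b c : ℝ) (M : ℕ) (r : Fin M → ℂ) : ℝ :=
  a / Real.pi ^ M *
    ∫ g in Set.Ioi (0 : ℝ), g ^ (-γ - 2 * (M : ℝ)) * Qfun b c g * Real.exp (-nsq r / g ^ 2)

theorem nsq_nonneg {M : ℕ} (r : Fin M → ℂ) : 0 ≤ nsq r :=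
  Finset.sum_nonneg fun _ _ => sq_nonneg _

theorem nsq_neg {M : ℕ} (r : Fin M → ℂ) : nsq (-r) = nsq r := by
  simp [nsq]

theorem norm_sq_le_nsq {M : ℕ} (r : Fin M → ℂ) : ‖r‖ ^ 2 ≤ nsq r := by
  have h : ‖r‖ ≤ √(nsq r) := (pi_norm_le_iff_of_nonneg (Real.sqrt_nonneg _)).2 fun i =>
    Real.le_sqrt_of_sq_le <|
      Finset.single_le_sum (f := fun i => ‖r i‖ ^ 2) (fun _ _ => sq_nonneg _) (Finset.mem_univ i)
  calc ‖r‖ ^ 2 ≤ √(nsq r) ^ 2 := by gcongr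
    _ = nsq r := Real.sq_sqrt (nsq_nonneg r)

theorem vgauss_pos (M : ℕ) {v : ℝ} (hv : 0 < v) (r : Fin M → ℂ) : 0 < vgauss M v r := by
  have := Real.pi_pos
  unfold vgauss
  positivity

theorem vgauss_neg (M : ℕ) (v : ℝ) (r : Fin M → ℂ) : vgauss M v (-r) = vgauss M v r := by
  simp only [vgauss, nsq_neg]

theorem continuous_vgauss (M : ℕ) (v : ℝ) : Continuous (vgauss M v) := by
  unfold vgauss nsq
  fun_prop

theorem vgauss_eq_prod (M : ℕ) (v : ℝ) (r : Fin M → ℂ) :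
    vgauss M v r = ∏ i, (Real.pi * v)⁻¹ * Real.exp (-v⁻¹ * ‖r i‖ ^ 2) := by
  rw [Finset.prod_mul_distrib, Finset.prod_const, ← Real.exp_sum, ← Finset.mul_sum]
  simp only [vgauss, nsq, Finset.card_univ, Fintype.card_fin, inv_pow]
  congr 2
  ring

theorem integral_exp_neg_inv_mul_norm_sq {v : ℝ} (hv : 0 < v) :
    ∫ z : ℂ, Real.exp (-v⁻¹ * ‖z‖ ^ 2) = Real.pi * v := by
  rw [GaussianFourier.integral_rexp_neg_mul_sq_norm (inv_pos.2 hv), Complex.finrank_real_complex]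
  simp

theorem integrable_exp_neg_inv_mul_norm_sq {v : ℝ} (hv : 0 < v) :
    Integrable fun z : ℂ => Real.exp (-v⁻¹ * ‖z‖ ^ 2) := by
  refine Integrable.of_integral_ne_zero ?_
  rw [integral_exp_neg_inv_mul_norm_sq hv]
  have := Real.pi_pos
  positivity

theorem integrable_vgauss (M : ℕ) {v : ℝ} (hv : 0 < v) : Integrable (vgauss M v) := by
  have h : vgauss M v = fun r => ∏ i, (Real.pi * v)⁻¹ * Real.exp (-v⁻¹ * ‖r i‖ ^ 2) :=
    funext (vgauss_eq_prod M v)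
  rw [h]
  exact Integrable.fintype_prod (f := fun _ z => (Real.pi * v)⁻¹ * Real.exp (-v⁻¹ * ‖z‖ ^ 2))
    fun _ => (integrable_exp_neg_inv_mul_norm_sq hv).const_mul _

theorem integral_vgauss (M : ℕ) {v : ℝ} (hv : 0 < v) : ∫ r, vgauss M v r = 1 := by
  have hpi := Real.pi_pos
  simp only [vgauss_eq_prod]
  rw [integral_fintype_prod_volume_eq_pow
    (fun z : ℂ => (Real.pi * v)⁻¹ * Real.exp (-v⁻¹ * ‖z‖ ^ 2)), integral_const_mul,
    integral_exp_neg_inv_mul_norm_sq hv, inv_mul_cancel₀ (by positivity), one_pow]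

theorem integrable_vgauss_smul_self (M : ℕ) {v : ℝ} (hv : 0 < v) :
    Integrable fun r => vgauss M v r • r := by
  refine ((integrable_vgauss M (mul_pos two_pos hv)).const_mul (2 ^ M * (1 + 2 * v))).mono'
    ((continuous_vgauss M v).smul continuous_id).aestronglyMeasurable
    (Filter.Eventually.of_forall fun r => ?_)
  have hpi := Real.pi_pos
  have hr : ‖r‖ ≤ (1 + 2 * v) * Real.exp (nsq r / (2 * v)) := by
    have h1 := Real.add_one_le_exp (nsq r / (2 * v))
    have h2 : nsq r = 2 * v * (nsq r / (2 * v)) := by field_simp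
    have h3 : 0 ≤ nsq r / (2 * v) := div_nonneg (nsq_nonneg r) (by positivity)
    have h4 := norm_sq_le_nsq r
    nlinarith [sq_nonneg (‖r‖ - 1)]
  have hexp : Real.exp (-nsq r / v) * Real.exp (nsq r / (2 * v)) =
      Real.exp (-nsq r / (2 * v)) := by
    rw [← Real.exp_add]
    congr 1
    field_simp
    ring
  rw [norm_smul, Real.norm_of_nonneg (vgauss_pos M hv r).le]
  calc vgauss M v r * ‖r‖
      ≤ vgauss M v r * ((1 + 2 * v) * Real.exp (nsq r / (2 * v))) := by
        gcongr
        exact (vgauss_pos M hv r).le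
    _ = ((Real.pi * v) ^ M)⁻¹ * (1 + 2 * v) *
          (Real.exp (-nsq r / v) * Real.exp (nsq r / (2 * v))) := by
        rw [vgauss]
        ring
    _ = 2 ^ M * (1 + 2 * v) * vgauss M (2 * v) r := by
        rw [hexp, vgauss]
        simp only [mul_pow]
        field_simp

theorem integral_vgauss_smul_self (M : ℕ) (v : ℝ) : ∫ r, vgauss M v r • r = 0 := by
  have h := integral_neg_eq_self (fun r : Fin M → ℂ => vgauss M v r • r) volume
  simp only [vgauss_neg, smul_neg, integral_neg] at h
  exact neg_eq_self.1 h

theorem integral_vgauss_sub_smul_self (M : ℕ) {v : ℝ} (hv : 0 < v) (c : Fin M → ℂ) :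
    ∫ r, vgauss M v (r - c) • r = c := by
  have h := integral_sub_right_eq_self (μ := volume)
    (fun r : Fin M → ℂ => vgauss M v r • (r + c)) c
  simp only [sub_add_cancel] at h
  rw [h]
  simp only [smul_add]
  rw [integral_add (integrable_vgauss_smul_self M hv) ((integrable_vgauss M hv).smul_const c),
    integral_vgauss_smul_self, integral_smul_const, integral_vgauss M hv, one_smul, zero_add]

/-- Completing the square in a product of two Gaussian densities. -/
theorem vgauss_mul_vgauss_sub (M : ℕ) {a b : ℝ} (ha : 0 < a) (hb : 0 < b) (x r : Fin M → ℂ) :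
    vgauss M a r * vgauss M b (x - r) =
      vgauss M (a + b) x * vgauss M (a * b / (a + b)) (r - (a / (a + b)) • x) := by
  have hpi := Real.pi_pos
  have hab : 0 < a + b := add_pos ha hb
  rw [vgauss_eq_prod, vgauss_eq_prod, vgauss_eq_prod, vgauss_eq_prod, ← Finset.prod_mul_distrib,
    ← Finset.prod_mul_distrib]
  refine Finset.prod_congr rfl fun i _ => ?_
  rw [mul_mul_mul_comm, mul_mul_mul_comm (Real.pi * (a + b))⁻¹, ← Real.exp_add, ← Real.exp_add]
  congr 1
  · field_simp
  · congr 1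
    simp only [Complex.sq_norm, Complex.normSq_apply, Pi.sub_apply, Pi.smul_apply,
      Complex.sub_re, Complex.sub_im, Complex.smul_re, Complex.smul_im, smul_eq_mul]
    field_simp
    ring

theorem integral_vgauss_mul_vgauss_sub (M : ℕ) {a b : ℝ} (ha : 0 < a) (hb : 0 < b)
    (x : Fin M → ℂ) : ∫ r, vgauss M a r * vgauss M b (x - r) = vgauss M (a + b) x := by
  simp only [vgauss_mul_vgauss_sub M ha hb]
  rw [integral_const_mul, integral_sub_right_eq_self (vgauss M (a * b / (a + b))),
    integral_vgauss M (by positivity), mul_one]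

theorem integral_vgauss_mul_vgauss_sub_smul_self (M : ℕ) {a b : ℝ} (ha : 0 < a) (hb : 0 < b)
    (x : Fin M → ℂ) : ∫ r, (vgauss M a r * vgauss M b (x - r)) • r =
      (vgauss M (a + b) x * (a / (a + b))) • x := by
  simp only [vgauss_mul_vgauss_sub M ha hb, mul_smul]
  rw [integral_smul, integral_vgauss_sub_smul_self M (by positivity)]

theorem vgauss_eq_mul_vgauss (M : ℕ) {u v : ℝ} (hu : 0 < u) (hv : 0 < v) (x : Fin M → ℂ) :
    vgauss M v x = (u / v) ^ M * Real.exp (-(1 / v - 1 / u) * nsq x) * vgauss M u x := by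
  have hpi := Real.pi_pos
  have hexp : Real.exp (-nsq x / v) =
      Real.exp (-(1 / v - 1 / u) * nsq x) * Real.exp (-nsq x / u) := by
    rw [← Real.exp_add]
    congr 1
    ring
  rw [vgauss, vgauss, hexp, div_pow, mul_pow, mul_pow]
  field_simp

/-- the vector MMSE denoiser with known large-scale fading `g` (Gaussian prior
`φ_{g²}^{(M)}` with activity probability `λ`) under complex Gaussian noise of variance `τ²`. -/
theorem stmt12
    (M : ℕ) (hM : 1 ≤ M)
    (g τ lam : ℝ) (hg : 0 < g) (hτ : 0 < τ) (hlam : lam ∈ Set.Ioo (0 : ℝ) 1)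
    (rt : Fin M → ℂ)
    (m Δ : ℝ)
    (hm : m = (1 - lam) * vgauss M (τ ^ 2) rt +
      lam * ∫ r : Fin M → ℂ, vgauss M (g ^ 2) r * vgauss M (τ ^ 2) (rt - r))
    (hΔ : Δ = 1 / τ ^ 2 - 1 / (g ^ 2 + τ ^ 2)) :
    0 < m ∧
      m⁻¹ • (lam • ∫ r : Fin M → ℂ, (vgauss M (g ^ 2) r * vgauss M (τ ^ 2) (rt - r)) • r) =
        ((g ^ 2 / (g ^ 2 + τ ^ 2)) /
          (1 + (1 - lam) / lam * ((g ^ 2 + τ ^ 2) / τ ^ 2) ^ M * Real.exp (-Δ * nsq rt))) • rt := by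
  have hg2 : 0 < g ^ 2 := by positivity
  have hτ2 : 0 < τ ^ 2 := by positivity
  obtain ⟨hl0, hl1⟩ := hlam
  have hl1' : 0 < 1 - lam := sub_pos.2 hl1
  have hB := vgauss_pos M (add_pos hg2 hτ2) rt
  have hA := vgauss_eq_mul_vgauss M (add_pos hg2 hτ2) hτ2 rt
  rw [integral_vgauss_mul_vgauss_sub M hg2 hτ2, hA, ← hΔ] at hm
  rw [integral_vgauss_mul_vgauss_sub_smul_self M hg2 hτ2]
  have hK : 0 < ((g ^ 2 + τ ^ 2) / τ ^ 2) ^ M := by positivity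
  have hE := Real.exp_pos (-Δ * nsq rt)
  generalize vgauss M (g ^ 2 + τ ^ 2) rt = B at *
  generalize ((g ^ 2 + τ ^ 2) / τ ^ 2) ^ M = K at *
  generalize Real.exp (-Δ * nsq rt) = E at *
  have hm0 : 0 < m := by
    rw [hm]
    positivity
  refine ⟨hm0, ?_⟩
  rw [smul_smul, smul_smul]
  congr 1
  have hm' : m = lam * B * (1 + (1 - lam) / lam * K * E) := by
    rw [hm]
    field_simp
    ring
  have hD : 0 < 1 + (1 - lam) / lam * K * E := by positivity
  rw [hm']
  field_simp
end
end

section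
/- Let M ≥ 1 be an integer and τ > 0, and define the likelihood-ratio function F(s) = ∫₀^∞ (a·τ^{2M}·g^{−γ}·Q(g)/(g²+τ²)^M)·exp(s·(1/τ² − 1/(g²+τ²))) dg for s ≥ 0. Then F(s) is finite for every s ≥ 0 and F is strictly increasing on [0, ∞). (Consequently the log-likelihood ratio of the activity hypothesis test is a monotonically increasing function of the magnitude of the matched-filter output, so the likelihood ratio test reduces to a threshold test on that magnitude.) -/
open MeasureTheory Set

noncomputable section

theorem integrable_exp_neg_sq : Integrable fun s : ℝ => Real.exp (-s ^ 2) := by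
  simpa using integrable_exp_neg_mul_sq (b := 1) one_pos

theorem antitone_setIntegral_Ioi_exp_neg_sq :
    Antitone fun t : ℝ => ∫ s in Ioi t, Real.exp (-s ^ 2) := fun _ _ h =>
  setIntegral_mono_set integrable_exp_neg_sq.integrableOn
    (Filter.Eventually.of_forall fun _ => (Real.exp_pos _).le) (Ioi_subset_Ioi h).eventuallyLE

/-- The Gaussian tail decays faster than any exponential. -/
theorem setIntegral_Ioi_exp_neg_sq_le (L : ℝ) (hL : 0 ≤ L) (t : ℝ) :
    ∫ s in Ioi t, Real.exp (-s ^ 2) ≤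
      Real.exp (-(L * t) + L ^ 2 / 2) * ∫ s, Real.exp (-(1 / 2) * s ^ 2) := by
  have hi : Integrable fun s : ℝ => Real.exp (-(1 / 2) * s ^ 2) :=
    integrable_exp_neg_mul_sq (by norm_num)
  rw [← integral_const_mul]
  refine (setIntegral_mono_on integrable_exp_neg_sq.integrableOn
    (hi.const_mul _).integrableOn measurableSet_Ioi fun s hs => ?_).trans
    (setIntegral_le_integral (hi.const_mul _)
      (Filter.Eventually.of_forall fun s => by positivity))
  rw [← Real.exp_add, Real.exp_le_exp]
  nlinarith [mul_le_mul_of_nonneg_left (le_of_lt hs) hL, sq_nonneg (L - s)]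

theorem Qfun_pos (b c g : ℝ) : 0 < Qfun b c g := by
  refine (setIntegral_pos_iff_support_of_nonneg_ae
    (Filter.Eventually.of_forall fun _ => (Real.exp_pos _).le)
    integrable_exp_neg_sq.integrableOn).2 ?_
  have h : (Function.support fun s : ℝ => Real.exp (-s ^ 2)) = univ :=
    Function.support_eq_univ fun s => (Real.exp_pos _).ne'
  rw [h, univ_inter, Real.volume_Ioi]
  exact ENNReal.zero_lt_top

theorem measurable_Qfun (b c : ℝ) : Measurable (Qfun b c) :=
  antitone_setIntegral_Ioi_exp_neg_sq.measurable.comp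
    ((Real.measurable_log.const_mul b).add_const c)

theorem Qfun_le (b c g : ℝ) : Qfun b c g ≤ ∫ s, Real.exp (-s ^ 2) :=
  setIntegral_le_integral integrable_exp_neg_sq
    (Filter.Eventually.of_forall fun _ => (Real.exp_pos _).le)

theorem exists_rpow_neg_mul_Qfun_le {b : ℝ} (hb : b < 0) (c : ℝ) {γ : ℝ} (hγ : 0 ≤ γ) :
    ∃ C, ∀ g, 0 < g → g ^ (-γ) * Qfun b c g ≤ C := by
  refine ⟨Real.exp (-(-γ / b * c) + (-γ / b) ^ 2 / 2) * ∫ s, Real.exp (-(1 / 2) * s ^ 2),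
    fun g hg => ?_⟩
  have hL : 0 ≤ -γ / b := div_nonneg_of_nonpos (by linarith) hb.le
  refine (mul_le_mul_of_nonneg_left (setIntegral_Ioi_exp_neg_sq_le _ hL _)
    (Real.rpow_nonneg hg.le _)).trans (le_of_eq ?_)
  rw [← mul_assoc, Real.rpow_def_of_pos hg, ← Real.exp_add]
  congr 2
  field_simp [hb.ne]
  ring

theorem integrableOn_rpow_neg_mul_Qfun {b : ℝ} (hb : b < 0) (c : ℝ) {γ : ℝ} (hγ : 1 < γ) :
    IntegrableOn (fun g : ℝ => g ^ (-γ) * Qfun b c g) (Ioi 0) := by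
  have hm : Measurable fun g : ℝ => g ^ (-γ) * Qfun b c g :=
    (measurable_id.pow_const _).mul (measurable_Qfun b c)
  rw [← Ioc_union_Ioi_eq_Ioi zero_le_one]
  refine IntegrableOn.union ?_ ?_
  · obtain ⟨C, hC⟩ := exists_rpow_neg_mul_Qfun_le hb c (zero_le_one.trans hγ.le)
    refine Measure.integrableOn_of_bounded (M := C) (by simp) hm.aestronglyMeasurable ?_
    filter_upwards [ae_restrict_mem measurableSet_Ioc] with g hg
    rw [Real.norm_of_nonneg (mul_nonneg (Real.rpow_nonneg hg.1.le _) (Qfun_pos b c g).le)]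
    exact hC g hg.1
  · refine ((integrableOn_Ioi_rpow_of_lt (a := -γ) (by linarith) one_pos).mul_const
      (∫ s, Real.exp (-s ^ 2))).mono' hm.aestronglyMeasurable ?_
    filter_upwards [ae_restrict_mem measurableSet_Ioi] with g hg
    have hg0 : 0 ≤ g := zero_le_one.trans (le_of_lt hg)
    rw [Real.norm_of_nonneg (mul_nonneg (Real.rpow_nonneg hg0 _) (Qfun_pos b c g).le)]
    exact mul_le_mul_of_nonneg_left (Qfun_le b c g) (Real.rpow_nonneg hg0 _)

/-- A pointwise strict inequality on a non-null set gives a strict inequality of integrals. -/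
theorem setIntegral_lt_setIntegral_of_lt_on {f g : ℝ → ℝ} {S : Set ℝ} (hS : MeasurableSet S)
    (hS0 : volume S ≠ 0) (hf : IntegrableOn f S) (hg : IntegrableOn g S)
    (h : ∀ x ∈ S, f x < g x) : ∫ x in S, f x < ∫ x in S, g x := by
  rw [← sub_pos, ← integral_sub hg hf]
  refine (setIntegral_pos_iff_support_of_nonneg_ae ?_ (hg.sub hf)).2 ?_
  · filter_upwards [ae_restrict_mem hS] with x hx using (sub_pos.2 (h x hx)).le
  · have hsub : S ⊆ Function.support (g - f) := fun x hx => (sub_pos.2 (h x hx)).ne'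
    rw [inter_eq_right.2 hsub]
    exact pos_iff_ne_zero.2 hS0

/-- the likelihood-ratio function
`F(s) = ∫₀^∞ (a τ^{2M} g^{-γ} Q(g)/(g²+τ²)^M) exp(s(1/τ² - 1/(g²+τ²))) dg`
is finite (the integrand is integrable on `(0,∞)`) for every `s ≥ 0`, and `F` is strictly
increasing on `[0,∞)`. -/
theorem stmt18
    (M : ℕ) (hM : 1 ≤ M)
    (R α β σ : ℝ) (hR : 0 < R) (hβ : 0 < β) (hσ : 0 < σ)
    (γ a b c : ℝ)
    (hγ : γ = 40 / β + 1)
    (ha : a = 40 / (R ^ 2 * β * Real.sqrt Real.pi) *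
      Real.exp (2 * (Real.log 10) ^ 2 * σ ^ 2 / β ^ 2 - 2 * (Real.log 10) * α / β))
    (hb : b = -10 * Real.sqrt 2 / ((Real.log 10) * σ))
    (hc : c = (-α - β * Real.logb 10 R) / (Real.sqrt 2 * σ) - 20 / (β * b))
    (τ : ℝ) (hτ : 0 < τ)
    (F : ℝ → ℝ)
    (hF : ∀ s, F s = ∫ g in Set.Ioi (0 : ℝ),
      a * τ ^ (2 * M) * g ^ (-γ) * Qfun b c g / (g ^ 2 + τ ^ 2) ^ M *
        Real.exp (s * (1 / τ ^ 2 - 1 / (g ^ 2 + τ ^ 2)))) :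
    (∀ s : ℝ, 0 ≤ s →
      IntegrableOn
        (fun g => a * τ ^ (2 * M) * g ^ (-γ) * Qfun b c g / (g ^ 2 + τ ^ 2) ^ M *
          Real.exp (s * (1 / τ ^ 2 - 1 / (g ^ 2 + τ ^ 2))))
        (Set.Ioi (0 : ℝ))) ∧
    StrictMonoOn F (Set.Ici (0 : ℝ)) := by
  have hb0 : b < 0 := by
    rw [hb]
    have : 0 < Real.log 10 := Real.log_pos (by norm_num)
    exact div_neg_of_neg_of_pos (by linarith [Real.sqrt_pos.2 (zero_lt_two' ℝ)]) (by positivity)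
  have ha0 : 0 < a := by rw [ha]; positivity
  have hγ1 : 1 < γ := by rw [hγ]; linarith [div_pos (by norm_num : (0 : ℝ) < 40) hβ]
  have hint : ∀ s : ℝ, 0 ≤ s → IntegrableOn
      (fun g => a * τ ^ (2 * M) * g ^ (-γ) * Qfun b c g / (g ^ 2 + τ ^ 2) ^ M *
        Real.exp (s * (1 / τ ^ 2 - 1 / (g ^ 2 + τ ^ 2)))) (Ioi (0 : ℝ)) := by
    intro s hs
    have hcont : Continuous fun g : ℝ => a * τ ^ (2 * M) / (g ^ 2 + τ ^ 2) ^ M *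
        Real.exp (s * (1 / τ ^ 2 - 1 / (g ^ 2 + τ ^ 2))) := by
      fun_prop (disch := intro g; positivity)
    refine ((integrableOn_rpow_neg_mul_Qfun hb0 c hγ1).bdd_mul
      (c := a * τ ^ (2 * M) / (τ ^ 2) ^ M * Real.exp (s * (1 / τ ^ 2)))
      hcont.aestronglyMeasurable (Filter.Eventually.of_forall fun g => ?_)).congr
      (Filter.Eventually.of_forall fun g => ?_)
    · rw [Real.norm_of_nonneg (by positivity)]
      have h1 : 0 ≤ 1 / (g ^ 2 + τ ^ 2) := by positivity
      gcongr
      · linarith [sq_nonneg g]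
      · linarith
    · ring
  refine ⟨hint, fun s hs t ht hst => ?_⟩
  rw [hF, hF]
  refine setIntegral_lt_setIntegral_of_lt_on measurableSet_Ioi (by simp) (hint s hs) (hint t ht)
    fun g (hg : 0 < g) => ?_
  have hQ := Qfun_pos b c g
  have hlt : 1 / (g ^ 2 + τ ^ 2) < 1 / τ ^ 2 :=
    one_div_lt_one_div_of_lt (by positivity) (by linarith [pow_pos hg 2])
  have hd : 0 < 1 / τ ^ 2 - 1 / (g ^ 2 + τ ^ 2) := sub_pos.2 hlt
  gcongr
end
end
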